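/- Let Γ be a blind MDP, p₁, p* ∈ Δ(K), and σ ∈ A^ℕ a strategy such that for every k ∈ Supp(p*), (1/n) Σ_{m=1}^n g_m → γ^k_∞(σ) P^k_σ-almost surely, and such that γ^{p*}_∞(σ) = v_∞(p₁). Then for every ε > 0 there exists an eventually periodic strategy σ' with γ^{p*}_∞(σ') ≥ v_∞(p₁) − ε. -/

import Mathlib

open MeasureTheory Filter

namespace PomdpPaper

/-- A belief (probability vector) on `Fin n`. -/
def IsBelief {n : ℕ} (p : Fin n → ℝ) : Prop :=
  (∀ k, 0 ≤ p k) ∧ ∑ k, p k = 1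

/-- The measure on a finite type associated with a probability vector. -/
noncomputable def vecMeasure {α : Type*} [Fintype α] [MeasurableSpace α] (p : α → ℝ) :
    Measure α :=
  ∑ x : α, ENNReal.ofReal (p x) • Measure.dirac x

/-- The Dirac belief at a point. -/
def diracBelief {n : ℕ} (k : Fin n) : Fin n → ℝ := fun k' => if k' = k then 1 else 0

/-- The `i`-th binary digit of a real number `x ∈ [0,1)` (as a real number `0` or `1`). -/
noncomputable def digitR (x : ℝ) (i : ℕ) : ℝ :=
  if ⌊x * 2 ^ (i + 1)⌋ % 2 = 1 then 1 else 0

/-- From one uniform seed `x ∈ [0,1)`, a sequence `unif x 0, unif x 1, …` of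
(independent, uniformly distributed on `[0,1]`) real numbers, obtained by splitting the
binary digits of `x` along the pairing function. -/
noncomputable def unif (x : ℝ) (m : ℕ) : ℝ :=
  ∑' j : ℕ, digitR x (Nat.pair m j) / 2 ^ (j + 1)

open Classical in
/-- Inverse-transform sampling from a probability vector on `Fin n` using a seed `u ∈ [0,1]`. -/
noncomputable def sampleFin {n : ℕ} (hn : 0 < n) (p : Fin n → ℝ) (u : ℝ) : Fin n :=
  let s : Finset (Fin n) :=
    Finset.univ.filter fun y : Fin n => u < ∑ z ∈ Finset.univ.filter fun z : Fin n => z ≤ y, p z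
  if hs : s.Nonempty then s.min' hs else ⟨0, hn⟩

/-- Inverse-transform sampling from a probability vector on a finite nonempty type. -/
noncomputable def sampleOn {β : Type*} [Fintype β] [Nonempty β] (p : β → ℝ) (u : ℝ) : β :=
  (Fintype.equivFin β).symm
    (sampleFin Fintype.card_pos (fun i => p ((Fintype.equivFin β).symm i)) u)

/-- A POMDP with states `Fin nK`, actions `Fin nA`, signals `Fin nS`, transition function `q`
and reward function `g` with values in `[0,1]`. -/
structure POMDP where
  nK : ℕ
  nA : ℕ
  nS : ℕ
  hK : 0 < nK
  hA : 0 < nA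
  hS : 0 < nS
  q : Fin nK → Fin nA → Fin nK × Fin nS → ℝ
  q_nonneg : ∀ k a y, 0 ≤ q k a y
  q_sum : ∀ k a, ∑ y, q k a y = 1
  g : Fin nK → Fin nA → ℝ
  g_nonneg : ∀ k a, 0 ≤ g k a
  g_le_one : ∀ k a, g k a ≤ 1

namespace POMDP

variable (Γ : POMDP)

/-- The state space. -/
abbrev K := Fin Γ.nK
/-- The action space. -/
abbrev A := Fin Γ.nA
/-- The signal space. -/
abbrev S := Fin Γ.nS

instance : Nonempty Γ.K := ⟨⟨0, Γ.hK⟩⟩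
instance : Nonempty Γ.A := ⟨⟨0, Γ.hA⟩⟩
instance : Nonempty Γ.S := ⟨⟨0, Γ.hS⟩⟩

/-- A history: the finite sequence of past actions and signals. -/
abbrev Hist := List (Γ.A × Γ.S)

/-- A (pure) strategy: a map from histories to actions. -/
abbrev Strategy := Γ.Hist → Γ.A

/-- The sample space carrying all the randomness: an initial state together with a
uniform seed in `[0,1)` used to draw all the transitions. -/
abbrev Env := Γ.K × ℝ

/-- The probability measure on the sample space induced by the initial belief `p1`:
the initial state is drawn according to `p1`, the seed uniformly on `[0,1)`. -/
noncomputable def envMeasure (p1 : Γ.K → ℝ) : Measure Γ.Env :=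
  (vecMeasure p1).prod (volume.restrict (Set.Ico (0 : ℝ) 1))

/-- The trajectory: `(Γ.traj σ ω m).1` is the state `k_{m+1}` at stage `m+1` and
`(Γ.traj σ ω m).2` is the history before stage `m+1` (of length `m`), when the
decision-maker uses strategy `σ` and the randomness is `ω`.  At each stage, the pair
(new state, signal) is drawn from `q` via inverse-transform sampling from a fresh
uniform variable. -/
noncomputable def traj (σ : Γ.Strategy) (ω : Γ.Env) : ℕ → Γ.K × Γ.Hist
  | 0 => (ω.1, [])
  | m + 1 =>
    let p := traj σ ω m
    let a := σ p.2
    let y := sampleOn (Γ.q p.1 a) (unif ω.2 m)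
    (y.1, p.2 ++ [(a, y.2)])

/-- The state `k_{m+1}` at stage `m+1` (`m` is 0-indexed). -/
noncomputable def state (σ : Γ.Strategy) (ω : Γ.Env) (m : ℕ) : Γ.K := (Γ.traj σ ω m).1

/-- The history before stage `m+1` (a list of length `m`). -/
noncomputable def hist (σ : Γ.Strategy) (ω : Γ.Env) (m : ℕ) : Γ.Hist := (Γ.traj σ ω m).2

/-- The action `a_{m+1}` played at stage `m+1`. -/
noncomputable def act (σ : Γ.Strategy) (ω : Γ.Env) (m : ℕ) : Γ.A := σ (Γ.hist σ ω m)

/-- The reward `g_{m+1}` obtained at stage `m+1`. -/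
noncomputable def rew (σ : Γ.Strategy) (ω : Γ.Env) (m : ℕ) : ℝ :=
  Γ.g (Γ.state σ ω m) (Γ.act σ ω m)

/-- The average reward over the first `n` stages. -/
noncomputable def avg (σ : Γ.Strategy) (ω : Γ.Env) (n : ℕ) : ℝ :=
  (1 / n : ℝ) * ∑ m ∈ Finset.range n, Γ.rew σ ω m

/-- The probability of an event under initial belief `p1` (the strategy `σ` is recorded for
readability; the underlying measure does not depend on it). -/
noncomputable def prob (p1 : Γ.K → ℝ) (_σ : Γ.Strategy) (E : Set Γ.Env) : ℝ :=
  (Γ.envMeasure p1 E).toReal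

/-- The long-run average payoff `γ^{p1}_∞(σ) = E[liminf (1/n) ∑ g_m]`. -/
noncomputable def pay (p1 : Γ.K → ℝ) (σ : Γ.Strategy) : ℝ :=
  ∫ ω, atTop.liminf (Γ.avg σ ω) ∂(Γ.envMeasure p1)

/-- The payoff starting from a deterministic state `k`, i.e. `γ^k_∞(σ)`. -/
noncomputable def payK (k : Γ.K) (σ : Γ.Strategy) : ℝ := Γ.pay (diracBelief k) σ

/-- The value `v_∞(p1)`. -/
noncomputable def val (p1 : Γ.K → ℝ) : ℝ := ⨆ σ : Γ.Strategy, Γ.pay p1 σ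

/-- A strategy has finite memory if it is implemented by a finite-state transducer. -/
def FiniteMemory (σ : Γ.Strategy) : Prop :=
  ∃ (n : ℕ) (m0 : Fin n) (σa : Fin n → Γ.A) (σu : Fin n → Γ.A × Γ.S → Fin n),
    ∀ h : Γ.Hist, σ h = σa (h.foldl σu m0)

/-- A blind MDP: the signal set is a singleton. -/
def Blind : Prop := Γ.nS = 1

/-- The strategy induced by a sequence of actions `a_1, a_2, …` (`as m` is the action played
at stage `m+1`, regardless of the observed history). -/
def blindStrat (as : ℕ → Γ.A) : Γ.Strategy := fun h => as h.length

end POMDP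

/-- A sequence is eventually periodic if it is periodic with some period `T ≥ 1` from
some stage `N` on. -/
def EventuallyPeriodic {α : Type*} (as : ℕ → α) : Prop :=
  ∃ T ≥ 1, ∃ N ≥ 1, ∀ m ≥ N, as (m + T) = as m



end PomdpPaper

open MeasureTheory Filter ProbabilityTheory
namespace PomdpPaper

noncomputable abbrev lam : Measure ℝ := volume.restrict (Set.Ico (0 : ℝ) 1)

instance lam_prob : IsProbabilityMeasure lam := ⟨by simp [lam]⟩

lemma digit_zero_left {y : ℝ} (hy : y ∈ Set.Ico (0:ℝ) 1) : digitR (y/2) 0 = 0 := by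
  have : ⌊y / 2 * 2 ^ (0+1)⌋ = 0 := by
    rw [Int.floor_eq_iff]; constructor <;> norm_num <;> linarith [hy.1, hy.2]
  simp only [digitR, this]; simp

lemma digit_zero_right {y : ℝ} (hy : y ∈ Set.Ico (0:ℝ) 1) : digitR ((y+1)/2) 0 = 1 := by
  have : ⌊(y+1) / 2 * 2 ^ (0+1)⌋ = 1 := by
    rw [Int.floor_eq_iff]; constructor <;> norm_num <;> linarith [hy.1, hy.2]
  simp only [digitR, this]; simp

lemma digit_succ_left (y : ℝ) (i : ℕ) : digitR (y/2) (i+1) = digitR y i := by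
  have : y / 2 * 2 ^ (i+1+1) = y * 2 ^ (i+1) := by ring
  simp only [digitR, this]

lemma digit_succ_right (y : ℝ) (i : ℕ) : digitR ((y+1)/2) (i+1) = digitR y i := by
  have : (y+1) / 2 * 2 ^ (i+1+1) = y * 2 ^ (i+1) + ((2 ^ (i+1) : ℤ) : ℝ) := by push_cast; ring
  simp only [digitR, this, Int.floor_add_intCast]
  have : (⌊y * 2 ^ (i+1)⌋ + 2 ^ (i+1) : ℤ) % 2 = ⌊y * 2 ^ (i+1)⌋ % 2 := by
    rw [pow_succ]; omega
  rw [this]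

lemma digit_meas (i : ℕ) : Measurable (fun x => digitR x i) := by
  unfold digitR
  have h : Measurable (fun x : ℝ => ⌊x * 2 ^ (i+1)⌋) := (measurable_id.mul_const _).floor
  exact Measurable.ite (h (t := {z : ℤ | z % 2 = 1}) trivial) measurable_const measurable_const

lemma lint_split (F : ℝ → ENNReal) :
    ∫⁻ x, F x ∂lam = 2⁻¹ * ∫⁻ y, F (y/2) ∂lam + 2⁻¹ * ∫⁻ y, F ((y+1)/2) ∂lam := by
  have e1 : (fun y : ℝ => y/2) '' Set.Ico 0 1 = Set.Ico 0 (1/2) := by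
    ext x; constructor
    · rintro ⟨y, hy, rfl⟩; simp only [Set.mem_Ico] at *; constructor <;> linarith
    · intro hx; refine ⟨2*x, ?_, by ring⟩; simp only [Set.mem_Ico] at *; constructor <;> linarith
  have e2 : (fun y : ℝ => (y+1)/2) '' Set.Ico 0 1 = Set.Ico (1/2) 1 := by
    ext x; constructor
    · rintro ⟨y, hy, rfl⟩; simp only [Set.mem_Ico] at *; constructor <;> linarith
    · intro hx; refine ⟨2*x-1, ?_, by ring⟩; simp only [Set.mem_Ico] at *; constructor <;> linarith
  have u : Set.Ico (0:ℝ) 1 = Set.Ico 0 (1/2) ∪ Set.Ico (1/2) 1 := by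
    rw [Set.Ico_union_Ico_eq_Ico] <;> norm_num
  have d : Disjoint (Set.Ico (0:ℝ) (1/2)) (Set.Ico (1/2) 1) := by
    rw [Set.disjoint_left]; intro x hx hx'; exact absurd hx.2 (not_lt.2 hx'.1)
  have c : ENNReal.ofReal |(1/2:ℝ)| = 2⁻¹ := by
    rw [abs_of_pos (by norm_num), one_div, ENNReal.ofReal_inv_of_pos (by norm_num)]; simp
  have i1 := lintegral_image_eq_lintegral_abs_deriv_mul (s := Set.Ico (0:ℝ) 1) measurableSet_Ico
    (f := fun y : ℝ => y/2) (f' := fun _ => 1/2)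
    (fun x _ => ((hasDerivAt_id x).div_const 2).hasDerivWithinAt)
    (fun a _ b _ h => by simp only at h; linarith) F
  have i2 := lintegral_image_eq_lintegral_abs_deriv_mul (s := Set.Ico (0:ℝ) 1) measurableSet_Ico
    (f := fun y : ℝ => (y+1)/2) (f' := fun _ => 1/2)
    (fun x _ => (((hasDerivAt_id x).add_const 1).div_const 2).hasDerivWithinAt)
    (fun a _ b _ h => by simp only at h; linarith) F
  rw [e1] at i1; rw [e2] at i2
  simp only [c] at i1 i2
  rw [lintegral_const_mul' _ _ (by simp)] at i1 i2
  rw [← i1, ← i2]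
  conv_lhs => rw [lam, u]
  rw [lintegral_union measurableSet_Ico d]

lemma lint_digits (n : ℕ) : ∀ h : ℕ → ℝ → ENNReal,
    ∫⁻ x, ∏ i ∈ Finset.range n, h i (digitR x i) ∂lam
      = ∏ i ∈ Finset.range n, (2⁻¹ * h i 0 + 2⁻¹ * h i 1) := by
  induction n with
  | zero => intro h; simp
  | succ n ih =>
    intro h
    rw [lint_split]
    have a1 : ∫⁻ y, ∏ i ∈ Finset.range (n+1), h i (digitR (y/2) i) ∂lam
        = (∏ i ∈ Finset.range n, (2⁻¹ * h (i+1) 0 + 2⁻¹ * h (i+1) 1)) * h 0 0 := by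
      rw [← ih (fun i => h (i+1)), ← lintegral_mul_const]
      · apply setLIntegral_congr_fun measurableSet_Ico
        intro y hy
        simp only [Finset.prod_range_succ', digit_zero_left hy, digit_succ_left]
      · apply Finset.measurable_prod
        intro i _
        have hm := digit_meas i
        have : (fun x => h (i+1) (digitR x i)) = fun x => if digitR x i = 1 then h (i+1) 1 else h (i+1) 0 := by
          funext x; unfold digitR; split_ifs <;> simp_all
        rw [this]
        exact Measurable.ite (hm (measurableSet_singleton 1)) measurable_const measurable_const
    have a2 : ∫⁻ y, ∏ i ∈ Finset.range (n+1), h i (digitR ((y+1)/2) i) ∂lam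
        = (∏ i ∈ Finset.range n, (2⁻¹ * h (i+1) 0 + 2⁻¹ * h (i+1) 1)) * h 0 1 := by
      rw [← ih (fun i => h (i+1)), ← lintegral_mul_const]
      · apply setLIntegral_congr_fun measurableSet_Ico
        intro y hy
        simp only [Finset.prod_range_succ', digit_zero_right hy, digit_succ_right]
      · apply Finset.measurable_prod
        intro i _
        have hm := digit_meas i
        have : (fun x => h (i+1) (digitR x i)) = fun x => if digitR x i = 1 then h (i+1) 1 else h (i+1) 0 := by
          funext x; unfold digitR; split_ifs <;> simp_all
        rw [this]
        exact Measurable.ite (hm (measurableSet_singleton 1)) measurable_const measurable_const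
    rw [a1, a2, Finset.prod_range_succ']
    ring

open Classical in
lemma digit_inter (S : Finset ℕ) (s : ℕ → Set ℝ) :
    lam (⋂ i ∈ S, (fun x => digitR x i) ⁻¹' s i)
      = ∏ i ∈ S, (2⁻¹ * (s i).indicator 1 0 + 2⁻¹ * (s i).indicator 1 1) := by
  obtain ⟨n, hn⟩ := S.exists_nat_subset_range
  have key := lint_digits n (fun i => if i ∈ S then (s i).indicator 1 else 1)
  have h1 : ∀ f : ℕ → ENNReal, ∏ i ∈ Finset.range n, (if i ∈ S then f i else 1) = ∏ i ∈ S, f i := by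
    intro f
    rw [Finset.prod_ite_mem, Finset.inter_eq_right.2 hn]
  have h2 : ∀ x, ∏ i ∈ Finset.range n, (if i ∈ S then (s i).indicator (1 : ℝ → ENNReal) else 1) (digitR x i)
      = (⋂ i ∈ S, (fun x => digitR x i) ⁻¹' s i).indicator 1 x := by
    intro x
    rw [← Finset.prod_congr rfl (fun i _ => (apply_ite (fun f : ℝ → ENNReal => f (digitR x i)) (i ∈ S) _ _).symm)]
    simp only [Pi.one_apply]
    rw [h1]
    by_cases hx : x ∈ (⋂ i ∈ S, (fun x => digitR x i) ⁻¹' s i)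
    · rw [Set.indicator_of_mem hx]
      apply Finset.prod_eq_one
      intro i hi
      simp only [Set.mem_iInter] at hx
      have hx' : digitR x i ∈ s i := hx i hi
      rw [Set.indicator_of_mem hx']; rfl
    · rw [Set.indicator_of_notMem hx]
      simp only [Set.mem_iInter, not_forall] at hx
      obtain ⟨i, hi, hx⟩ := hx
      have hx' : digitR x i ∉ s i := hx
      exact Finset.prod_eq_zero hi (Set.indicator_of_notMem hx' _)
  simp only [h2] at key
  have hmeas : MeasurableSet (⋂ i ∈ S, (fun x => digitR x i) ⁻¹' s i) := by
    refine Finset.measurableSet_biInter S fun i _ => ?_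
    have : (fun x => digitR x i) ⁻¹' s i = (fun x => digitR x i) ⁻¹' (s i ∩ {0,1}) := by
      ext x
      have : digitR x i ∈ ({0,1} : Set ℝ) := by unfold digitR; split_ifs <;> simp
      simp [this]
    rw [this]
    exact digit_meas i ((Set.toFinite _).measurableSet)
  rw [lintegral_indicator_one hmeas] at key
  rw [key, ← h1]
  apply Finset.prod_congr rfl
  intro i _
  split_ifs
  · rfl
  · simp [ENNReal.inv_two_add_inv_two]

lemma digit_single (i : ℕ) (s : Set ℝ) :
    lam ((fun x => digitR x i) ⁻¹' s) = 2⁻¹ * s.indicator 1 0 + 2⁻¹ * s.indicator 1 1 := by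
  simpa using digit_inter {i} (fun _ => s)

lemma digit_indep : iIndepFun (fun i x => digitR x i) lam := by
  rw [iIndepFun_iff_measure_inter_preimage_eq_mul]
  intro S sets _
  rw [digit_inter]
  exact Finset.prod_congr rfl fun i _ => (digit_single i _).symm

lemma digit_eq (x : ℝ) (hx : x ∈ Set.Ico (0:ℝ) 1) : ∑' j, digitR x j / 2^(j+1) = x := by
  have h := Real.hasSum_ofDigitsTerm_digits x (b := 2) (by norm_num) hx
  rw [← h.tsum_eq]
  conv_lhs => rw [h.tsum_eq]
  refine tsum_congr fun j => ?_
  simp only [Real.ofDigitsTerm, Real.digits, digitR, div_eq_mul_inv]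
  have e : (⌊x * 2 ^ (j+1)⌋₊ : ℤ) = ⌊x * 2 ^ (j+1)⌋ := Int.natCast_floor_eq_floor (by have := hx.1; positivity)
  have e2 : ((⌊x * 2 ^ (j+1)⌋₊ % 2 : ℕ) : ℤ) = ⌊x * 2 ^ (j+1)⌋ % 2 := by rw [← e]; simp
  have : (if ⌊x * 2 ^ (j + 1)⌋ % 2 = 1 then (1:ℝ) else 0) = ((⌊x * 2 ^ (j+1)⌋₊ % 2 : ℕ) : ℝ) := by
    rcases Nat.mod_two_eq_zero_or_one ⌊x * 2 ^ (j+1)⌋₊ with h | h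
    · rw [h] at e2 ⊢; rw [← e2]; simp
    · rw [h] at e2 ⊢; rw [← e2]; simp
  rw [this]
  simp [Fin.ofNat]

lemma unif_law (m : ℕ) : lam.map (fun x => unif x m) = lam := by
  have h1 := digit_indep.map_fun_eq_infinitePi_map digit_meas
  have hinj : Function.Injective (fun j => Nat.pair m j) := fun a b h => (Nat.pair_eq_pair.1 h).2
  have h2 := (digit_indep.precomp hinj).map_fun_eq_infinitePi_map (fun j => digit_meas (Nat.pair m j))
  have hsame : ∀ i j, lam.map (fun x => digitR x i) = lam.map (fun x => digitR x j) := by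
    intro i j
    ext s hs
    rw [Measure.map_apply (digit_meas i) hs, Measure.map_apply (digit_meas j) hs, digit_single, digit_single]
  have h3 : lam.map (fun x j => digitR x (Nat.pair m j)) = lam.map (fun x j => digitR x j) := by
    rw [h1, h2]
    congr 1
    funext j
    exact hsame _ _
  have hG : Measurable (fun b : ℕ → ℝ => ∑' j, b j / 2^(j+1)) := by
    exact Measurable.tsum fun j => (measurable_pi_apply j).div_const _
  have m1 : Measurable (fun (x:ℝ) j => digitR x (Nat.pair m j)) := measurable_pi_lambda _ fun j => digit_meas _
  have m2 : Measurable (fun (x:ℝ) j => digitR x j) := measurable_pi_lambda _ fun j => digit_meas _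
  have h4 := congrArg (fun μ => Measure.map (fun b : ℕ → ℝ => ∑' j, b j / 2^(j+1)) μ) h3
  simp only [Measure.map_map hG m1, Measure.map_map hG m2] at h4
  change lam.map (fun x => unif x m) = _ at h4
  rw [h4]
  conv_rhs => rw [← Measure.map_id (μ := lam)]
  apply Measure.map_congr
  filter_upwards [ae_restrict_mem measurableSet_Ico] with x hx
  exact digit_eq x hx

end PomdpPaper


open MeasureTheory Filter ProbabilityTheory
namespace PomdpPaper

@[reducible] noncomputable def digSig (n : ℕ) : MeasurableSpace ℝ := MeasurableSpace.comap (fun x => digitR x n) inferInstance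

@[reducible] noncomputable def Fil (m : ℕ) : MeasurableSpace ℝ := ⨆ n ∈ {n : ℕ | (Nat.unpair n).1 < m}, digSig n

lemma digSig_le (n : ℕ) : digSig n ≤ Real.measurableSpace :=
  (digit_meas n).comap_le

lemma Fil_le (m : ℕ) : Fil m ≤ Real.measurableSpace :=
  iSup₂_le fun n _ => digSig_le n

lemma Fil_mono {m n : ℕ} (h : m ≤ n) : Fil m ≤ Fil n :=
  biSup_mono fun _ hi => lt_of_lt_of_le hi h

lemma tsum_dig_meas {Ω : Type} [MeasurableSpace Ω] (f : ℕ → Ω → ℝ) (hf : ∀ j, Measurable (f j)) :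
    Measurable (fun w => ∑' j, f j w / 2^(j+1)) :=
  Measurable.tsum fun j => (hf j).div_const _

lemma unif_meas_sig (m : ℕ) (M : MeasurableSpace ℝ) (hM : ∀ j, digSig (Nat.pair m j) ≤ M) :
    @Measurable ℝ ℝ M Real.measurableSpace (fun x => unif x m) :=
  @tsum_dig_meas ℝ M (fun j x => digitR x (Nat.pair m j))
    (fun j => Measurable.mono (comap_measurable _) (hM j) le_rfl)

lemma unif_meas_fil {i m : ℕ} (h : i < m) : @Measurable ℝ ℝ (Fil m) Real.measurableSpace (fun x => unif x i) := by
  apply unif_meas_sig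
  intro j
  exact le_biSup digSig (i := Nat.pair i j) (by simpa using h)

lemma unif_meas (m : ℕ) : Measurable (fun x => unif x m) :=
  (unif_meas_fil (Nat.lt_succ_self m)).mono (Fil_le _) le_rfl

lemma fil_indep (m : ℕ) :
    Indep (Fil m) (MeasurableSpace.comap (fun x => unif x m) Real.measurableSpace) lam := by
  have h := indep_iSup_of_disjoint (m := digSig) (μ := lam) digSig_le digit_indep
    (S := {n : ℕ | (Nat.unpair n).1 < m}) (T := {n : ℕ | (Nat.unpair n).1 = m})
    (by rw [Set.disjoint_left]; intro a ha hb; exact absurd hb (ne_of_lt ha))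
  refine indep_of_indep_of_le_right h ?_
  apply Measurable.comap_le
  apply unif_meas_sig
  intro j
  exact le_biSup digSig (i := Nat.pair m j) (by simp)

lemma sampleFin_meas {n : ℕ} (hn : 0 < n) (p : Fin n → ℝ) : Measurable (sampleFin hn p) := by
  classical
  let G : (Fin n → Prop) → Fin n := fun t =>
    if hs : (Finset.univ.filter fun y => t y).Nonempty then (Finset.univ.filter fun y => t y).min' hs
    else ⟨0, hn⟩
  have hG : Measurable G := measurable_of_finite G
  have hc : Measurable (fun (u : ℝ) (y : Fin n) => u < ∑ z ∈ Finset.univ.filter fun z : Fin n => z ≤ y, p z) := by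
    refine measurable_pi_lambda _ fun y => ?_
    exact measurableSet_setOfPred.1 measurableSet_Iio
  have : sampleFin hn p = G ∘ (fun (u : ℝ) (y : Fin n) => u < ∑ z ∈ Finset.univ.filter fun z : Fin n => z ≤ y, p z) := by
    funext u
    simp only [sampleFin, G, Function.comp]
  rw [this]
  exact hG.comp hc

lemma sampleFin_eq {n : ℕ} (hn : 0 < n) (p : Fin n → ℝ) (hp : ∀ y, 0 ≤ p y) (y : Fin n) (u : ℝ)
    (h1 : ∑ z ∈ Finset.univ.filter (fun z : Fin n => z < y), p z ≤ u)
    (h2 : u < ∑ z ∈ Finset.univ.filter (fun z : Fin n => z ≤ y), p z) : sampleFin hn p u = y := by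
  classical
  have hy : y ∈ (Finset.univ.filter fun y : Fin n => u < ∑ z ∈ Finset.univ.filter fun z : Fin n => z ≤ y, p z) := by
    simpa using h2
  unfold sampleFin
  simp only
  rw [dif_pos ⟨y, by convert hy⟩]
  apply le_antisymm
  · apply Finset.min'_le; convert hy
  · apply Finset.le_min'
    intro y' hy'
    by_contra hlt
    push Not at hlt
    have : u < ∑ z ∈ Finset.univ.filter fun z : Fin n => z ≤ y', p z := by
      simpa using hy'
    have h3 : ∑ z ∈ Finset.univ.filter (fun z : Fin n => z ≤ y'), p z ≤
        ∑ z ∈ Finset.univ.filter (fun z : Fin n => z < y), p z := by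
      apply Finset.sum_le_sum_of_subset_of_nonneg
      · intro z hz; simp only [Finset.mem_filter, Finset.mem_univ, true_and] at *; exact lt_of_le_of_lt hz hlt
      · intro i _ _; exact hp i
    linarith

lemma sampleFin_ge {n : ℕ} (hn : 0 < n) (p : Fin n → ℝ) (hp : ∀ y, 0 ≤ p y) (hs : ∑ y, p y = 1)
    (y : Fin n) : p y ≤ lam.real {u | sampleFin hn p u = y} := by
  classical
  set a := ∑ z ∈ Finset.univ.filter (fun z : Fin n => z < y), p z with ha
  set b := ∑ z ∈ Finset.univ.filter (fun z : Fin n => z ≤ y), p z with hb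
  have hab : b = a + p y := by
    have : Finset.univ.filter (fun z : Fin n => z ≤ y) = insert y (Finset.univ.filter (fun z : Fin n => z < y)) := by
      ext z; simp [le_iff_eq_or_lt]
    rw [hb, this, Finset.sum_insert (by simp), add_comm]
  have ha0 : 0 ≤ a := Finset.sum_nonneg fun i _ => hp i
  have hb1 : b ≤ 1 := by
    rw [← hs]; exact Finset.sum_le_sum_of_subset_of_nonneg (Finset.filter_subset _ _) fun i _ _ => hp i
  have hsub : Set.Ico a b ⊆ {u | sampleFin hn p u = y} := fun u hu => sampleFin_eq hn p hp y u hu.1 hu.2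
  have : lam.real (Set.Ico a b) = p y := by
    rw [measureReal_restrict_apply measurableSet_Ico,
      Set.inter_eq_left.2 (Set.Ico_subset_Ico ha0 hb1)]
    simp [hab, hp y]
  rw [← this]
  exact measureReal_mono hsub

lemma sampleFin_law {n : ℕ} (hn : 0 < n) (p : Fin n → ℝ) (hp : ∀ y, 0 ≤ p y) (hs : ∑ y, p y = 1)
    (y : Fin n) : lam.real {u | sampleFin hn p u = y} = p y := by
  have htot : ∑ y, lam.real {u | sampleFin hn p u = y} = 1 := by
    have h := sum_measureReal_preimage_singleton (μ := lam) (f := sampleFin hn p) Finset.univ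
      (fun y _ => sampleFin_meas hn p (measurableSet_singleton y))
    rw [Finset.coe_univ, Set.preimage_univ, probReal_univ] at h
    exact h
  have := (Finset.sum_eq_sum_iff_of_le (fun y (_ : y ∈ Finset.univ) => sampleFin_ge hn p hp hs y)).1
    (by rw [htot, hs])
  exact (this y (Finset.mem_univ y)).symm

lemma sampleOn_meas {β : Type*} [Fintype β] [Nonempty β] [MeasurableSpace β] (p : β → ℝ) :
    Measurable (sampleOn p) := by
  unfold sampleOn
  exact (measurable_of_finite _).comp (sampleFin_meas _ _)

lemma sampleOn_int {β : Type*} [Fintype β] [Nonempty β] (p : β → ℝ) (hp : ∀ y, 0 ≤ p y)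
    (hs : ∑ y, p y = 1) (h : β → ℝ) : ∫ u, h (sampleOn p u) ∂lam = ∑ y, p y * h y := by
  set e := Fintype.equivFin β
  have hm := sampleFin_meas (Fintype.card_pos (α := β)) (fun i => p (e.symm i))
  have h1 : ∫ u, h (sampleOn p u) ∂lam
      = ∫ i, h (e.symm i) ∂(lam.map (sampleFin (Fintype.card_pos (α := β)) (fun i => p (e.symm i)))) := by
    rw [integral_map hm.aemeasurable (by measurability)]
    rfl
  have : IsProbabilityMeasure (lam.map (sampleFin (Fintype.card_pos (α := β)) (fun i => p (e.symm i)))) :=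
    Measure.isProbabilityMeasure_map hm.aemeasurable
  rw [h1, integral_fintype (Integrable.of_finite), ← e.symm.sum_comp]
  refine Finset.sum_congr rfl fun i _ => ?_
  rw [map_measureReal_apply hm (measurableSet_singleton _)]
  have := sampleFin_law (Fintype.card_pos (α := β)) (fun i => p (e.symm i)) (fun i => hp _)
    (by rw [e.symm.sum_comp]; exact hs) i
  have e2 : sampleFin (Fintype.card_pos (α := β)) (fun i => p (e.symm i)) ⁻¹' {i} = {u | sampleFin (Fintype.card_pos (α := β)) (fun i => p (e.symm i)) u = i} := rfl
  rw [e2, this, smul_eq_mul]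

end PomdpPaper


open MeasureTheory Filter ProbabilityTheory
namespace PomdpPaper
namespace POMDP
variable (Γ : POMDP)

/-- state process -/
noncomputable def X (as : ℕ → Γ.A) (k : Γ.K) (m : ℕ) (x : ℝ) : Γ.K :=
  Γ.state (Γ.blindStrat as) (k, x) m

lemma hist_length (as : ℕ → Γ.A) (ω : Γ.Env) (m : ℕ) :
    (Γ.traj (Γ.blindStrat as) ω m).2.length = m := by
  induction m with
  | zero => rfl
  | succ m ih => simp [traj, ih]

lemma X_zero (as : ℕ → Γ.A) (k : Γ.K) (x : ℝ) : Γ.X as k 0 x = k := rfl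

lemma X_succ (as : ℕ → Γ.A) (k : Γ.K) (m : ℕ) (x : ℝ) :
    Γ.X as k (m+1) x = (sampleOn (Γ.q (Γ.X as k m x) (as m)) (unif x m)).1 := by
  have := Γ.hist_length as (k, x) m
  simp only [X, state, traj]
  rw [show Γ.blindStrat as (Γ.traj (Γ.blindStrat as) (k, x) m).2 = as m by simp [blindStrat, this]]

lemma rew_eq (as : ℕ → Γ.A) (k : Γ.K) (m : ℕ) (x : ℝ) :
    Γ.rew (Γ.blindStrat as) (k, x) m = Γ.g (Γ.X as k m x) (as m) := by
  have := Γ.hist_length as (k, x) m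
  simp only [rew, act, hist]
  rw [show Γ.blindStrat as (Γ.traj (Γ.blindStrat as) (k, x) m).2 = as m by simp [blindStrat, this]]
  rfl

lemma fin_par_meas {Ω κ : Type} [MeasurableSpace Ω] [MeasurableSpace κ] [Countable κ] [MeasurableSingletonClass κ] (G : κ → ℝ → κ) 
   (hG : ∀ k, Measurable (G k)) (f : Ω → κ) (u : Ω → ℝ)
    (hf : Measurable f) (hu : Measurable u) :
    Measurable (fun w => G (f w) (u w)) := by
  have h3 : Measurable (fun z : κ × ℝ => G z.1 z.2) := measurable_from_prod_countable_right hG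
  exact h3.comp (hf.prodMk hu)

lemma st_meas (a : Γ.A) (k : Γ.K) : Measurable (fun u => (sampleOn (Γ.q k a) u).1) := by
    have h1 := sampleOn_meas (Γ.q k a)
    have h2 : Measurable (fun y : Γ.K × Γ.S => y.1) := measurable_fst
    exact h2.comp h1

lemma step_meas {Ω : Type} [MeasurableSpace Ω] (a : Γ.A) (f : Ω → Γ.K) (u : Ω → ℝ)
    (hf : Measurable f) (hu : Measurable u) :
    Measurable (fun w => (sampleOn (Γ.q (f w) a) (u w)).1) := 
  fin_par_meas (fun k u => (sampleOn (Γ.q k a) u).1) (Γ.st_meas a) f u hf hu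

lemma X_meas (as : ℕ → Γ.A) (k : Γ.K) {m n : ℕ} (h : m ≤ n) :
    Measurable[Fil n] (Γ.X as k m) := by
  induction m with
  | zero => exact measurable_const
  | succ m ih =>
    have h1 := ih (by omega)
    have h2 : @Measurable _ _ (Fil n) Real.measurableSpace (fun x => unif x m) := unif_meas_fil (by omega)
    have e : Γ.X as k (m+1) = fun x => (sampleOn (Γ.q (Γ.X as k m x) (as m)) (unif x m)).1 :=
      funext fun x => Γ.X_succ as k m x
    rw [e]
    exact @step_meas Γ ℝ (Fil n) (as m) (Γ.X as k m) (fun x => unif x m) h1 h2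

lemma X_meas' (as : ℕ → Γ.A) (k : Γ.K) (m : ℕ) : Measurable (Γ.X as k m) :=
  (Γ.X_meas as k (le_refl m)).mono (Fil_le _) le_rfl

/-- one-step operator -/
noncomputable def Op (a : Γ.A) (h : Γ.K → ℝ) (k : Γ.K) : ℝ := ∑ y, Γ.q k a y * h y.1

lemma bdd_int {F : ℝ → ℝ} (hF : Measurable F) (C : ℝ) (hC : ∀ x, |F x| ≤ C) : Integrable F lam :=
  Integrable.of_bound hF.aestronglyMeasurable C (Eventually.of_forall hC)

lemma markov (as : ℕ → Γ.A) (k : Γ.K) (m : ℕ) (F : ℝ → ℝ) (hF : Measurable[Fil m] F)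
    (C : ℝ) (hC : ∀ x, |F x| ≤ C) (h : Γ.K → ℝ) :
    ∫ x, F x * h (Γ.X as k (m+1) x) ∂lam = ∫ x, F x * Γ.Op (as m) h (Γ.X as k m x) ∂lam := by
  classical
  have hF' : Measurable F := hF.mono (Fil_le _) le_rfl
  set I : Γ.K → ℝ → ℝ := fun j x => F x * (if Γ.X as k m x = j then 1 else 0) with hI
  have hIm : ∀ j, Measurable[Fil m] (I j) := fun j =>
    hF.mul (Measurable.ite (Γ.X_meas as k le_rfl (measurableSet_singleton j)) measurable_const measurable_const)
  have hIm' : ∀ j, Measurable (I j) := fun j => (hIm j).mono (Fil_le _) le_rfl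
  have hIb : ∀ j x, |I j x| ≤ C := by
    intro j x
    simp only [hI, abs_mul]
    have := abs_nonneg (F x)
    split_ifs <;> simp <;> linarith [hC x]
  set H : Γ.K → ℝ → ℝ := fun j x => h (sampleOn (Γ.q j (as m)) (unif x m)).1 with hH
  have hHg : ∀ j, Measurable (fun u => h (sampleOn (Γ.q j (as m)) u).1) := fun j =>
    (measurable_of_finite (fun y : Γ.K × Γ.S => h y.1)).comp (sampleOn_meas _)
  have hHm : ∀ j, Measurable (H j) := fun j => (hHg j).comp (unif_meas m)
  have hHint : ∀ j, ∫ x, H j x ∂lam = Γ.Op (as m) h j := by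
    intro j
    have := integral_map (μ := lam) (unif_meas m).aemeasurable (f := fun u => h (sampleOn (Γ.q j (as m)) u).1)
      (hHg j).aestronglyMeasurable
    rw [unif_law] at this
    rw [← this, sampleOn_int _ (Γ.q_nonneg j (as m)) (Γ.q_sum j (as m)) (fun y => h y.1)]
    rfl
  have hind : ∀ j, IndepFun (I j) (H j) lam := by
    intro j
    rw [IndepFun_iff_Indep]
    refine indep_of_indep_of_le_left (indep_of_indep_of_le_right (fil_indep m) ?_) ?_
    · exact ((hHg j).comp (comap_measurable _)).comap_le
    · exact (hIm j).comap_le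
  obtain ⟨D, hD⟩ : ∃ D, ∀ j, |h j| ≤ D :=
    ⟨∑ j, |h j|, fun j => Finset.single_le_sum (f := fun j => |h j|) (fun i _ => abs_nonneg _) (Finset.mem_univ j)⟩
  have hIi : ∀ j, Integrable (I j) lam := fun j => bdd_int (hIm' j) C (hIb j)
  have hIHi : ∀ j, Integrable (fun x => I j x * H j x) lam := fun j =>
    bdd_int ((hIm' j).mul (hHm j)) (C * D) (fun x => by
      rw [abs_mul]; exact mul_le_mul (hIb j x) (hD _) (abs_nonneg _) ((abs_nonneg _).trans (hIb j x)))
  calc ∫ x, F x * h (Γ.X as k (m+1) x) ∂lam = ∫ x, ∑ j, I j x * H j x ∂lam := by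
        congr 1; funext x
        simp only [hI, hH, mul_ite, mul_one, mul_zero, ite_mul, zero_mul]
        rw [Finset.sum_ite_eq]; simp [Γ.X_succ]
    _ = ∑ j, ∫ x, I j x * H j x ∂lam := integral_finsetSum _ fun j _ => hIHi j
    _ = ∑ j, ∫ x, I j x * Γ.Op (as m) h j ∂lam := by
        refine Finset.sum_congr rfl fun j _ => ?_
        rw [(hind j).integral_fun_mul_eq_mul_integral (hIm' j).aestronglyMeasurable (hHm j).aestronglyMeasurable,
          integral_mul_const, hHint]
    _ = ∫ x, ∑ j, I j x * Γ.Op (as m) h j ∂lam := (integral_finsetSum _ fun j _ => (hIi j).mul_const _).symm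
    _ = _ := by
        congr 1; funext x
        simp only [hI, mul_ite, mul_one, mul_zero, ite_mul, zero_mul]
        rw [Finset.sum_ite_eq]; simp

/-- expected total reward over `n` stages from stage `m` -/
noncomputable def V (as : ℕ → Γ.A) : ℕ → ℕ → Γ.K → ℝ
  | _, 0 => fun _ => 0
  | m, n+1 => fun k => Γ.g k (as m) + Γ.Op (as m) (V as (m+1) n) k

lemma V_congr (as bs : ℕ → Γ.A) (n : ℕ) : ∀ m m' : ℕ, (∀ i < n, as (m+i) = bs (m'+i)) →
    Γ.V as m n = Γ.V bs m' n := by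
  induction n with
  | zero => intros; rfl
  | succ n ih =>
    intro m m' h
    have h0 : as m = bs m' := by simpa using h 0 (by omega)
    have := ih (m+1) (m'+1) (fun i hi => by
      have := h (i+1) (by omega)
      rwa [show m + 1 + i = m + (i+1) by ring, show m' + 1 + i = m' + (i+1) by ring])
    funext k
    simp only [V, h0, this]

lemma markov_sum (as : ℕ → Γ.A) (k : Γ.K) (n : ℕ) : ∀ (m : ℕ) (F : ℝ → ℝ) (_ : Measurable[Fil m] F)
    (C : ℝ) (_ : ∀ x, |F x| ≤ C),
    ∫ x, F x * ∑ i ∈ Finset.range n, Γ.g (Γ.X as k (m+i) x) (as (m+i)) ∂lam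
      = ∫ x, F x * Γ.V as m n (Γ.X as k m x) ∂lam := by
  induction n with
  | zero => intros; simp [V]
  | succ n ih =>
    intro m F hF C hC
    have hF' : Measurable F := hF.mono (Fil_le _) le_rfl
    have h1 := ih (m+1) F (hF.mono (Fil_mono (by omega)) le_rfl) C hC
    rw [Γ.markov as k m F hF C hC] at h1
    have gm : ∀ (f : Γ.K → ℝ) i, Integrable (fun x => F x * f (Γ.X as k i x)) lam := by
      intro f i
      obtain ⟨D, hD⟩ : ∃ D, ∀ j, |f j| ≤ D :=
        ⟨∑ j, |f j|, fun j => Finset.single_le_sum (f := fun j => |f j|) (fun i _ => abs_nonneg _) (Finset.mem_univ j)⟩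
      refine bdd_int (hF'.mul ((measurable_of_finite f).comp (Γ.X_meas' as k i))) (C*D) fun x => ?_
      rw [abs_mul]; exact mul_le_mul (hC x) (hD _) (abs_nonneg _) ((abs_nonneg _).trans (hC x))
    simp only [V, mul_add]
    rw [integral_add (gm (fun j => Γ.g j (as m)) m) (gm (Γ.Op (as m) (Γ.V as (m+1) n)) m), ← h1,
      ← integral_add (gm (fun j => Γ.g j (as m)) m)]
    · congr 1; funext x
      rw [Finset.sum_range_succ', mul_add, add_comm]
      congr 2
      refine Finset.sum_congr rfl fun i _ => ?_
      rw [show m + (i+1) = m + 1 + i by ring]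
    · simp only [Finset.mul_sum]
      exact integrable_finsetSum _ fun i _ => gm (fun j => Γ.g j (as (m+1+i))) (m+1+i)

end POMDP
end PomdpPaper


open MeasureTheory Filter ProbabilityTheory
namespace PomdpPaper
open POMDP

lemma orth_sq (Z : ℕ → ℝ → ℝ) (hZ : ∀ j, Measurable (Z j)) (C : ℝ) (hC : ∀ j x, |Z j x| ≤ C)
    (ho : ∀ i j, i < j → ∫ x, Z i x * Z j x ∂lam = 0) (n : ℕ) :
    ∫ x, (∑ j ∈ Finset.range n, Z j x)^2 ∂lam ≤ n * C^2 := by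
  have hS : ∀ n, Measurable (fun x => ∑ j ∈ Finset.range n, Z j x) := fun n =>
    Finset.measurable_sum _ fun j _ => hZ j
  have hSb : ∀ n x, |∑ j ∈ Finset.range n, Z j x| ≤ n * C := by
    intro n x
    refine (Finset.abs_sum_le_sum_abs _ _).trans ?_
    refine (Finset.sum_le_sum fun j _ => hC j x).trans ?_
    simp
  have hC0 : 0 ≤ C := (abs_nonneg _).trans (hC 0 0)
  have hprod : ∀ i j, Integrable (fun x => Z i x * Z j x) lam := fun i j =>
    bdd_int ((hZ i).mul (hZ j)) (C*C) fun x => by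
      rw [abs_mul]; exact mul_le_mul (hC _ _) (hC _ _) (abs_nonneg _) hC0
  induction n with
  | zero => simp
  | succ n ih =>
    have e : ∀ x, (∑ j ∈ Finset.range (n+1), Z j x)^2
        = (∑ j ∈ Finset.range n, Z j x)^2 + (2 * (∑ j ∈ Finset.range n, Z j x * Z n x) + Z n x * Z n x) := by
      intro x; rw [Finset.sum_range_succ, ← Finset.sum_mul]; ring
    simp only [e]
    have i1 : Integrable (fun x => (∑ j ∈ Finset.range n, Z j x)^2) lam :=
      bdd_int ((hS n).pow_const 2) ((n*C)^2) fun x => by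
        rw [abs_pow]; exact pow_le_pow_left₀ (abs_nonneg _) (hSb n x) 2
    have i2 : Integrable (fun x => (∑ j ∈ Finset.range n, Z j x * Z n x)) lam :=
      integrable_finsetSum _ fun j _ => hprod j n
    have i3 : Integrable (fun x => 2 * (∑ j ∈ Finset.range n, Z j x * Z n x) + Z n x * Z n x) lam :=
      (i2.const_mul 2).add (hprod n n)
    rw [integral_add i1 i3, integral_add (i2.const_mul 2) (hprod n n),
      integral_const_mul, integral_finsetSum _ (fun j _ => hprod j n),
      Finset.sum_eq_zero (fun j hj => ho j n (Finset.mem_range.1 hj))]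
    have : ∫ x, Z n x * Z n x ∂lam ≤ C^2 := by
      calc ∫ x, Z n x * Z n x ∂lam ≤ ∫ x, C^2 ∂lam := by
            refine integral_mono (hprod n n) (integrable_const _) fun x => ?_
            have := hC n x
            rw [← pow_two, ← sq_abs]; exact pow_le_pow_left₀ (abs_nonneg _) this 2
        _ = C^2 := by simp
    push_cast
    linarith

lemma slln (Z : ℕ → ℝ → ℝ) (hZ : ∀ j, Measurable (Z j)) (C : ℝ) (hC : ∀ j x, |Z j x| ≤ C)
    (ho : ∀ i j, i < j → ∫ x, Z i x * Z j x ∂lam = 0) :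
    ∀ᵐ x ∂lam, Tendsto (fun n : ℕ => (∑ j ∈ Finset.range n, Z j x) / n) atTop (nhds 0) := by
  have hC0 : 0 ≤ C := (abs_nonneg _).trans (hC 0 0)
  set S : ℕ → ℝ → ℝ := fun n x => ∑ j ∈ Finset.range n, Z j x with hSdef
  have hS : ∀ n, Measurable (S n) := fun n => Finset.measurable_sum _ fun j _ => hZ j
  have hSb : ∀ n x, |S n x| ≤ n * C := by
    intro n x
    refine (Finset.abs_sum_le_sum_abs _ _).trans ?_
    refine (Finset.sum_le_sum fun j _ => hC j x).trans ?_
    simp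
  set W : ℕ → ℝ → ℝ := fun n x => (S (n^2) x / (n^2 : ℕ))^2 with hW
  have hWm : ∀ n, Measurable (W n) := fun n => ((hS _).div_const _).pow_const 2
  have hWi : ∀ n, ∫ x, W n x ∂lam ≤ C^2 * (1 / (n:ℝ)^2) := by
    intro n
    simp only [hW, div_pow]
    rw [integral_div]
    have := orth_sq Z hZ C hC ho (n^2)
    rcases Nat.eq_zero_or_pos n with rfl | hn
    · simp
    have hn' : (0:ℝ) < n := by exact_mod_cast hn
    rw [div_le_iff₀ (by positivity)]
    refine this.trans (le_of_eq ?_)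
    push_cast
    field_simp
  have hWint : ∀ n, Integrable (W n) lam := by
    intro n
    refine bdd_int (hWm n) (C^2) fun x => ?_
    simp only [hW]
    rw [abs_pow, abs_div]
    refine pow_le_pow_left₀ (by positivity) ?_ 2
    rcases Nat.eq_zero_or_pos n with rfl | hn
    · simpa using hC0
    have hn' : (0:ℝ) < n := by exact_mod_cast hn
    rw [Nat.abs_cast, div_le_iff₀ (by push_cast; positivity)]
    linarith [hSb (n^2) x]
  have hsum : Summable (fun n : ℕ => C^2 * (1 / (n:ℝ)^2)) :=
    (Real.summable_one_div_nat_pow.2 (by norm_num)).mul_left _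
  have hfin : ∫⁻ x, ∑' n, ENNReal.ofReal (W n x) ∂lam ≠ ⊤ := by
    rw [lintegral_tsum fun n => (hWm n).ennreal_ofReal.aemeasurable]
    have : ∀ n, ∫⁻ x, ENNReal.ofReal (W n x) ∂lam ≤ ENNReal.ofReal (C^2 * (1 / (n:ℝ)^2)) := by
      intro n
      rw [← ofReal_integral_eq_lintegral_ofReal (hWint n) (Eventually.of_forall fun x => sq_nonneg _)]
      exact ENNReal.ofReal_le_ofReal (hWi n)
    refine ne_top_of_le_ne_top ?_ (ENNReal.tsum_le_tsum this)
    rw [← ENNReal.ofReal_tsum_of_nonneg (fun n => by positivity) hsum]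
    exact ENNReal.ofReal_ne_top
  filter_upwards [ae_lt_top (Measurable.tsum fun n => (hWm n).ennreal_ofReal) hfin] with x hx
  have h1 := ENNReal.tendsto_atTop_zero_of_tsum_ne_top hx.ne
  have h2 : Tendsto (fun n => W n x) atTop (nhds 0) := by
    have := (ENNReal.tendsto_toReal (by simp : (0:ENNReal) ≠ ⊤)).comp h1
    simpa [Function.comp_def, ENNReal.toReal_ofReal (sq_nonneg _), hW] using this
  have h3 : Tendsto (fun n : ℕ => |S (n^2) x / (n^2 : ℕ)|) atTop (nhds 0) := by
    have := h2.sqrt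
    simpa [hW, Real.sqrt_sq_eq_abs] using this
  have hsq : Tendsto Nat.sqrt atTop atTop := by
    refine tendsto_atTop.2 fun b => ?_
    filter_upwards [eventually_ge_atTop (b*b)] with n hn
    exact Nat.le_sqrt.2 hn
  have h4 : Tendsto (fun n : ℕ => |S (n^2) x / (n^2 : ℕ)| + 2 * C / n) atTop (nhds 0) := by
    simpa using h3.add (tendsto_const_div_atTop_nhds_zero_nat (2*C))
  have h5 := h4.comp hsq
  refine squeeze_zero_norm' ?_ h5
  filter_upwards [eventually_ge_atTop 1] with n hn
  simp only [Function.comp, Real.norm_eq_abs]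
  set r := Nat.sqrt n with hr
  have hr1 : 1 ≤ r := Nat.le_sqrt.2 (by simpa using hn)
  have hrn : r^2 ≤ n := Nat.sqrt_le' n
  have hnr : n ≤ r^2 + 2 * r := by have := Nat.sqrt_le_add n; rw [← hr] at this; nlinarith
  have hdiff : |S n x - S (r^2) x| ≤ 2 * r * C := by
    have : S n x - S (r^2) x = ∑ j ∈ Finset.Ico (r^2) n, Z j x := by
      simp only [hSdef]; rw [Finset.sum_Ico_eq_sub _ hrn]
    rw [this]
    refine (Finset.abs_sum_le_sum_abs _ _).trans ?_
    refine (Finset.sum_le_sum fun j _ => hC j x).trans ?_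
    simp only [Finset.sum_const, Nat.card_Ico, nsmul_eq_mul]
    gcongr
    have : n - r^2 ≤ 2 * r := by omega
    exact_mod_cast this
  have hr' : (0:ℝ) < r := by exact_mod_cast hr1
  have hrn' : (r:ℝ)^2 ≤ n := by exact_mod_cast hrn
  have hSn : |S n x| ≤ |S (r^2) x| + 2 * r * C := by
    have := abs_add_le (S n x - S (r^2) x) (S (r^2) x)
    rw [sub_add_cancel] at this; linarith
  rw [abs_div, abs_div, Nat.abs_cast, Nat.abs_cast]
  calc |S n x| / n ≤ (|S (r^2) x| + 2 * r * C) / (r:ℝ)^2 := by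
        exact div_le_div₀ (by positivity) hSn (by positivity) hrn'
    _ = _ := by push_cast; field_simp

end PomdpPaper


open MeasureTheory Filter ProbabilityTheory
namespace PomdpPaper
namespace POMDP
variable (Γ : POMDP)

lemma avg_eq (as : ℕ → Γ.A) (k : Γ.K) (x : ℝ) (n : ℕ) : Γ.avg (Γ.blindStrat as) (k, x) n
    = (1 / n : ℝ) * ∑ m ∈ Finset.range n, Γ.g (Γ.X as k m x) (as m) := by
  simp only [avg, rew_eq]

lemma avg_nonneg (as : ℕ → Γ.A) (ω : Γ.Env) (n : ℕ) : 0 ≤ Γ.avg (Γ.blindStrat as) ω n :=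
  mul_nonneg (by positivity) (Finset.sum_nonneg fun _ _ => Γ.g_nonneg _ _)

lemma avg_le_one (as : ℕ → Γ.A) (ω : Γ.Env) (n : ℕ) : Γ.avg (Γ.blindStrat as) ω n ≤ 1 := by
  have : ∑ m ∈ Finset.range n, Γ.rew (Γ.blindStrat as) ω m ≤ n := by
    refine (Finset.sum_le_sum fun m _ => Γ.g_le_one _ _).trans ?_
    simp
  unfold avg
  rcases Nat.eq_zero_or_pos n with rfl | hn
  · simp
  · have hn' : (0:ℝ) < n := by exact_mod_cast hn
    rw [one_div, inv_mul_le_iff₀ hn', mul_one]; exact this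

lemma g_meas (as : ℕ → Γ.A) (k : Γ.K) (m : ℕ) : Measurable (fun x => Γ.g (Γ.X as k m x) (as m)) :=
  (measurable_of_finite (fun j => Γ.g j (as m))).comp (Γ.X_meas' as k m)

lemma avg_meas (as : ℕ → Γ.A) (n : ℕ) : Measurable (fun ω => Γ.avg (Γ.blindStrat as) ω n) := by
  apply measurable_from_prod_countable_right
  intro k
  simp only [avg_eq]
  exact (Finset.measurable_sum _ fun m _ => Γ.g_meas as k m).const_mul _

lemma liminf_meas (as : ℕ → Γ.A) : Measurable (fun ω => atTop.liminf (Γ.avg (Γ.blindStrat as) ω)) :=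
  Measurable.liminf (Γ.avg_meas as)

lemma bddBelow_avg (as : ℕ → Γ.A) (ω : Γ.Env) :
    IsBoundedUnder (· ≥ ·) atTop (Γ.avg (Γ.blindStrat as) ω) :=
  isBoundedUnder_of ⟨0, fun n => Γ.avg_nonneg as ω n⟩

lemma bddAbove_avg (as : ℕ → Γ.A) (ω : Γ.Env) :
    IsBoundedUnder (· ≤ ·) atTop (Γ.avg (Γ.blindStrat as) ω) :=
  isBoundedUnder_of ⟨1, fun n => Γ.avg_le_one as ω n⟩

lemma le_liminf_avg (as : ℕ → Γ.A) (ω : Γ.Env) (c : ℝ)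
    (h : ∀ᶠ n in atTop, c ≤ Γ.avg (Γ.blindStrat as) ω n) :
    c ≤ atTop.liminf (Γ.avg (Γ.blindStrat as) ω) :=
  le_liminf_of_le (Γ.bddAbove_avg as ω).isCoboundedUnder_ge h

lemma liminf_nonneg (as : ℕ → Γ.A) (ω : Γ.Env) : 0 ≤ atTop.liminf (Γ.avg (Γ.blindStrat as) ω) :=
  Γ.le_liminf_avg as ω 0 (Eventually.of_forall fun n => Γ.avg_nonneg as ω n)

lemma liminf_le_one (as : ℕ → Γ.A) (ω : Γ.Env) : atTop.liminf (Γ.avg (Γ.blindStrat as) ω) ≤ 1 :=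
  liminf_le_of_frequently_le (Frequently.of_forall fun n => Γ.avg_le_one as ω n) (Γ.bddBelow_avg as ω)

lemma vec_fin (p : Γ.K → ℝ) : IsFiniteMeasure (vecMeasure p) := by
  constructor
  simp [vecMeasure]

lemma pay_eq (p : Γ.K → ℝ) (hp : ∀ k, 0 ≤ p k) (as : ℕ → Γ.A) :
    Γ.pay p (Γ.blindStrat as)
      = ∑ k, p k * ∫ x, atTop.liminf (Γ.avg (Γ.blindStrat as) (k, x)) ∂lam := by
  have := Γ.vec_fin p
  unfold pay envMeasure
  have hint : Integrable (fun ω : Γ.Env => atTop.liminf (Γ.avg (Γ.blindStrat as) ω))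
      ((vecMeasure p).prod lam) := by
    refine Integrable.of_bound (Γ.liminf_meas as).aestronglyMeasurable 1 (Eventually.of_forall fun ω => ?_)
    rw [Real.norm_eq_abs, abs_of_nonneg (Γ.liminf_nonneg as ω)]
    exact Γ.liminf_le_one as ω
  rw [integral_prod _ hint]
  unfold vecMeasure
  rw [integral_finsetSum_measure]
  · refine Finset.sum_congr rfl fun k _ => ?_
    rw [integral_smul_measure, integral_dirac, ENNReal.toReal_ofReal (hp k), smul_eq_mul]
  · intro k _
    exact (integrable_dirac (by simp)).smul_measure (by simp)

lemma payK_eq (k : Γ.K) (as : ℕ → Γ.A) :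
    Γ.payK k (Γ.blindStrat as) = ∫ x, atTop.liminf (Γ.avg (Γ.blindStrat as) (k, x)) ∂lam := by
  unfold payK
  rw [pay_eq]
  · simp [diracBelief]
  · intro k'; unfold diracBelief; split_ifs <;> simp

lemma ae_of_env (k : Γ.K) (P : Γ.Env → Prop) (h : ∀ᵐ ω ∂(Γ.envMeasure (diracBelief k)), P ω) :
    ∀ᵐ x ∂lam, P (k, x) := by
  have := Γ.vec_fin (diracBelief k)
  have h1 := Measure.ae_ae_of_ae_prod h
  have h2 : vecMeasure (diracBelief k) = Measure.dirac k := by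
    unfold vecMeasure diracBelief
    rw [Finset.sum_eq_single k] <;> simp +contextual
  rw [h2, ae_dirac_eq] at h1
  exact h1

open Classical in
/-- indicator of a state -/
noncomputable def ind (y : Γ.K) (j : Γ.K) : ℝ := if j = y then 1 else 0

/-- transition probability -/
noncomputable def tr (a : Γ.A) (x y : Γ.K) : ℝ := Γ.Op a (Γ.ind y) x

lemma ind_nonneg (y j : Γ.K) : 0 ≤ Γ.ind y j := by unfold ind; split_ifs <;> simp
lemma ind_le (y j : Γ.K) : Γ.ind y j ≤ 1 := by unfold ind; split_ifs <;> simp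
lemma ind_abs (y j : Γ.K) : |Γ.ind y j| ≤ 1 := by
  rw [abs_of_nonneg (Γ.ind_nonneg y j)]; exact Γ.ind_le y j

lemma tr_nonneg (a : Γ.A) (x y : Γ.K) : 0 ≤ Γ.tr a x y :=
  Finset.sum_nonneg fun _ _ => mul_nonneg (Γ.q_nonneg _ _ _) (Γ.ind_nonneg _ _)

noncomputable def pr (as : ℕ → Γ.A) (k : Γ.K) (m : ℕ) (y : Γ.K) : ℝ := ∫ x, Γ.ind y (Γ.X as k m x) ∂lam

lemma ind_meas (as : ℕ → Γ.A) (k : Γ.K) (m : ℕ) (y : Γ.K) :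
    Measurable[Fil m] (fun x => Γ.ind y (Γ.X as k m x)) :=
  (measurable_of_finite (Γ.ind y)).comp (Γ.X_meas as k le_rfl)

lemma ind_int (as : ℕ → Γ.A) (k : Γ.K) (m : ℕ) (y : Γ.K) :
    Integrable (fun x => Γ.ind y (Γ.X as k m x)) lam :=
  bdd_int ((Γ.ind_meas as k m y).mono (Fil_le _) le_rfl) 1 fun _ => Γ.ind_abs _ _

lemma pr_nonneg (as : ℕ → Γ.A) (k : Γ.K) (m : ℕ) (y : Γ.K) : 0 ≤ Γ.pr as k m y :=
  integral_nonneg fun _ => Γ.ind_nonneg _ _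

lemma pr_succ (as : ℕ → Γ.A) (k : Γ.K) (m : ℕ) (y : Γ.K) :
    Γ.pr as k (m+1) y = ∑ j, Γ.pr as k m j * Γ.tr (as m) j y := by
  have h := Γ.markov as k m (fun _ => 1) measurable_const 1 (by simp) (Γ.ind y)
  simp only [one_mul] at h
  unfold pr
  rw [h]
  simp_rw [← integral_mul_const]
  rw [← integral_finsetSum _ (fun j _ => (Γ.ind_int as k m j).mul_const _)]
  congr 1; funext x
  simp [ind, tr]

def stepS (a : Γ.A) (B : Set Γ.K) : Set Γ.K := {y | ∃ x ∈ B, 0 < Γ.tr a x y}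

def R (as : ℕ → Γ.A) (m : ℕ) : ℕ → Set Γ.K → Set Γ.K
  | 0, B => B
  | n+1, B => Γ.stepS (as (m+n)) (R as m n B)

lemma R_add (as : ℕ → Γ.A) (l m n : ℕ) (B : Set Γ.K) :
    Γ.R as l (m+n) B = Γ.R as (l+m) n (Γ.R as l m B) := by
  induction n with
  | zero => rfl
  | succ n ih => rw [← add_assoc]; simp only [R, ih, add_assoc]

lemma R_congr (as bs : ℕ → Γ.A) (m m' n : ℕ) (B : Set Γ.K) (h : ∀ i < n, as (m+i) = bs (m'+i)) :
    Γ.R as m n B = Γ.R bs m' n B := by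
  induction n with
  | zero => rfl
  | succ n ih => simp only [R]; rw [h n (by omega), ih fun i hi => h i (by omega)]

lemma mem_R_iff (as : ℕ → Γ.A) (k : Γ.K) (m : ℕ) (y : Γ.K) :
    y ∈ Γ.R as 0 m {k} ↔ 0 < Γ.pr as k m y := by
  induction m generalizing y with
  | zero =>
    simp only [R, Set.mem_singleton_iff, pr, X_zero, ind]
    by_cases h : k = y
    · simp [h]
    · simp [h, Ne.symm h]
  | succ m ih =>
    simp only [R, stepS, Set.mem_ofPred_eq, pr_succ, zero_add]
    constructor
    · rintro ⟨x, hx, ht⟩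
      refine Finset.sum_pos' (fun j _ => mul_nonneg (Γ.pr_nonneg _ _ _ _) (Γ.tr_nonneg _ _ _)) ⟨x, Finset.mem_univ _, mul_pos ((ih x).1 hx) ht⟩
    · intro h
      obtain ⟨x, -, hx⟩ := Finset.exists_lt_of_sum_lt (f := fun _ => (0:ℝ)) (by simpa using h)
      have h1 := Γ.pr_nonneg as k m x
      have h2 := Γ.tr_nonneg (as m) x y
      refine ⟨x, (ih x).2 (lt_of_le_of_ne h1 ?_), lt_of_le_of_ne h2 ?_⟩
      · intro e; rw [← e] at hx; simp at hx
      · intro e; rw [← e] at hx; simp at hx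

lemma ae_mem_R (as : ℕ → Γ.A) (k : Γ.K) (m : ℕ) : ∀ᵐ x ∂lam, Γ.X as k m x ∈ Γ.R as 0 m {k} := by
  have : ∀ y, ∀ᵐ x ∂lam, Γ.X as k m x = y → y ∈ Γ.R as 0 m {k} := by
    intro y
    by_cases hy : y ∈ Γ.R as 0 m {k}
    · exact Eventually.of_forall fun _ _ => hy
    · rw [mem_R_iff] at hy
      have h0 : Γ.pr as k m y = 0 := le_antisymm (not_lt.1 hy) (Γ.pr_nonneg _ _ _ _)
      unfold pr at h0
      rw [integral_eq_zero_iff_of_nonneg (fun _ => Γ.ind_nonneg _ _) (Γ.ind_int as k m y)] at h0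
      filter_upwards [h0] with x hx e
      simp [ind, e] at hx
  filter_upwards [ae_all_iff.2 this] with x hx
  exact hx _ rfl

lemma V_tendsto (as : ℕ → Γ.A) (k : Γ.K) (γ : ℝ) (N : ℕ) (y : Γ.K) (hy : 0 < Γ.pr as k N y)
    (herg : ∀ᵐ x ∂lam, Tendsto (Γ.avg (Γ.blindStrat as) (k, x)) atTop (nhds γ)) :
    Tendsto (fun n : ℕ => Γ.V as N n y / n) atTop (nhds γ) := by
  have key : ∀ n : ℕ, Γ.V as N n y / n = (∫ x, Γ.ind y (Γ.X as k N x) *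
      ((∑ i ∈ Finset.range n, Γ.g (Γ.X as k (N+i) x) (as (N+i))) / n) ∂lam) / Γ.pr as k N y := by
    intro n
    rw [eq_div_iff hy.ne']
    have := Γ.markov_sum as k n N _ (Γ.ind_meas as k N y) 1 (fun _ => Γ.ind_abs _ _)
    simp_rw [← mul_div_assoc]
    rw [integral_div, this]
    have e : ∀ x, Γ.ind y (Γ.X as k N x) * Γ.V as N n (Γ.X as k N x) = Γ.ind y (Γ.X as k N x) * Γ.V as N n y := by
      intro x; unfold ind; split_ifs with h
      · rw [h]
      · simp
    simp only [e]
    rw [integral_mul_const]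
    unfold pr; ring
  simp only [key]
  have hlim : Tendsto (fun n : ℕ => ∫ x, Γ.ind y (Γ.X as k N x) *
      ((∑ i ∈ Finset.range n, Γ.g (Γ.X as k (N+i) x) (as (N+i))) / n) ∂lam) atTop
      (nhds (∫ x, Γ.ind y (Γ.X as k N x) * γ ∂lam)) := by
    refine tendsto_integral_of_dominated_convergence (fun _ => 1) ?_ (integrable_const _) ?_ ?_
    · intro n
      exact (((Γ.ind_meas as k N y).mono (Fil_le _) le_rfl).mul
        ((Finset.measurable_sum _ fun i _ => Γ.g_meas as k (N+i)).div_const _)).aestronglyMeasurable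
    · intro n
      refine Eventually.of_forall fun x => ?_
      have h0 : 0 ≤ ∑ i ∈ Finset.range n, Γ.g (Γ.X as k (N+i) x) (as (N+i)) :=
        Finset.sum_nonneg fun _ _ => Γ.g_nonneg _ _
      have h1 : ∑ i ∈ Finset.range n, Γ.g (Γ.X as k (N+i) x) (as (N+i)) ≤ n := by
        refine (Finset.sum_le_sum fun m _ => Γ.g_le_one _ _).trans ?_
        simp
      have h2 : (∑ i ∈ Finset.range n, Γ.g (Γ.X as k (N+i) x) (as (N+i))) / n ≤ 1 :=
        div_le_one_of_le₀ h1 (by positivity)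
      rw [Real.norm_eq_abs, abs_mul, abs_of_nonneg (a := _ / _) (by positivity)]
      exact mul_le_one₀ (Γ.ind_abs _ _) (by positivity) h2
    · filter_upwards [herg] with x hx
      refine Tendsto.const_mul _ ?_
      have t1 : Tendsto (fun n : ℕ => Γ.avg (Γ.blindStrat as) (k, x) (n + N)) atTop (nhds γ) :=
        hx.comp (tendsto_add_atTop_nat N)
      have t2 : Tendsto (fun n : ℕ => 1 + (N:ℝ) / n) atTop (nhds 1) := by
        simpa using (tendsto_const_nhds (x := (1:ℝ))).add (tendsto_const_div_atTop_nhds_zero_nat (N:ℝ))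
      have t3 := tendsto_const_div_atTop_nhds_zero_nat (∑ m ∈ Finset.range N, Γ.g (Γ.X as k m x) (as m))
      have t4 := (t2.mul t1).sub t3
      rw [one_mul, sub_zero] at t4
      refine t4.congr' ?_
      filter_upwards [eventually_gt_atTop 0] with n hn
      have hn' : (0:ℝ) < n := by exact_mod_cast hn
      rw [avg_eq, add_comm n N, Finset.sum_range_add]
      push_cast
      field_simp
      ring
  have := hlim.div_const (Γ.pr as k N y)
  rw [integral_mul_const] at this
  change Tendsto _ _ (nhds (Γ.pr as k N y * γ / Γ.pr as k N y)) at this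
  rwa [mul_div_cancel_left₀ _ hy.ne'] at this

end POMDP
end PomdpPaper


open MeasureTheory Filter ProbabilityTheory
namespace PomdpPaper
namespace POMDP
variable (Γ : POMDP)

lemma sum_blocks (r : ℕ → ℝ) (N T J : ℕ) : ∑ m ∈ Finset.range (N + J * T), r m
    = ∑ m ∈ Finset.range N, r m + ∑ j ∈ Finset.range J, ∑ i ∈ Finset.range T, r (N + j * T + i) := by
  induction J with
  | zero => simp
  | succ J ih =>
    rw [show N + (J+1) * T = N + J * T + T by ring, Finset.sum_range_add, ih, Finset.sum_range_succ, add_assoc]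

lemma block (as bs : ℕ → Γ.A) (k : Γ.K) (N T : ℕ) (hT : 1 ≤ T)
    (hper : ∀ j i, i < T → bs (N + j * T + i) = as (N + i)) (c : Set Γ.K)
    (hR : ∀ j, Γ.R bs 0 (N + j * T) {k} = c) (γ δ : ℝ) (hγ : γ ≤ 1) (hδ : 0 < δ)
    (hV : ∀ y ∈ c, (T:ℝ) * (γ - δ) ≤ Γ.V as N T y) :
    ∀ᵐ x ∂lam, γ - 3 * δ ≤ atTop.liminf (Γ.avg (Γ.blindStrat bs) (k, x)) := by
  set Y : ℕ → ℝ → ℝ := fun j x => ∑ i ∈ Finset.range T, Γ.g (Γ.X bs k (N + j*T + i) x) (bs (N + j*T + i)) with hY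
  set Z : ℕ → ℝ → ℝ := fun j x => Y j x - Γ.V as N T (Γ.X bs k (N + j*T) x) with hZ
  obtain ⟨D, hD⟩ : ∃ D, ∀ j, |Γ.V as N T j| ≤ D :=
    ⟨∑ j, |Γ.V as N T j|, fun j => Finset.single_le_sum (f := fun j => |Γ.V as N T j|) (fun i _ => abs_nonneg _) (Finset.mem_univ j)⟩
  have hYb : ∀ j x, |Y j x| ≤ T := by
    intro j x
    rw [abs_of_nonneg (Finset.sum_nonneg fun _ _ => Γ.g_nonneg _ _)]
    refine (Finset.sum_le_sum fun m _ => Γ.g_le_one _ _).trans ?_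
    simp
  have hZb : ∀ j x, |Z j x| ≤ T + D := by
    intro j x
    refine (abs_sub _ _).trans (add_le_add (hYb j x) (hD _))
  have hYm : ∀ j n, N + j*T + T ≤ n → Measurable[Fil n] (Y j) := by
    intro j n hn
    refine Finset.measurable_sum _ fun i hi => ?_
    rw [Finset.mem_range] at hi
    exact (measurable_of_finite (fun s => Γ.g s (bs (N + j*T + i)))).comp (Γ.X_meas bs k (by omega))
  have hVm : ∀ j n, N + j*T ≤ n → Measurable[Fil n] (fun x => Γ.V as N T (Γ.X bs k (N + j*T) x)) := by
    intro j n hn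
    exact (measurable_of_finite _).comp (Γ.X_meas bs k hn)
  have hZm : ∀ j n, N + j*T + T ≤ n → Measurable[Fil n] (Z j) := by
    intro j n hn
    exact (hYm j n hn).sub (hVm j n (by omega))
  have hZm' : ∀ j, Measurable (Z j) := fun j => (hZm j _ le_rfl).mono (Fil_le _) le_rfl
  have hYm' : ∀ j, Measurable (Y j) := fun j => (hYm j _ le_rfl).mono (Fil_le _) le_rfl
  have hVm' : ∀ j, Measurable (fun x => Γ.V as N T (Γ.X bs k (N + j*T) x)) := fun j =>
    (hVm j _ le_rfl).mono (Fil_le _) le_rfl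
  have ho : ∀ i j, i < j → ∫ x, Z i x * Z j x ∂lam = 0 := by
    intro i j hij
    have hle : N + i*T + T ≤ N + j*T := by nlinarith
    have h1 := Γ.markov_sum bs k T (N + j*T) (Z i) (hZm i _ hle) (T + D) (hZb i)
    have h2 : Γ.V bs (N + j*T) T = Γ.V as N T := Γ.V_congr _ _ _ _ _ (hper j)
    rw [h2] at h1
    have e : ∀ x, Z i x * Z j x = Z i x * Y j x - Z i x * Γ.V as N T (Γ.X bs k (N + j*T) x) := by
      intro x; simp only [hZ]; ring
    have hTD : (0:ℝ) ≤ T + D := (abs_nonneg _).trans (hZb 0 0)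
    simp only [e]
    rw [integral_sub, h1, sub_self]
    · refine bdd_int ((hZm' i).mul (hYm' j)) ((T + D) * T) fun x => ?_
      rw [abs_mul]; exact mul_le_mul (hZb i x) (hYb j x) (abs_nonneg _) hTD
    · refine bdd_int ((hZm' i).mul (hVm' j)) ((T + D) * D) fun x => ?_
      rw [abs_mul]; exact mul_le_mul (hZb i x) (hD _) (abs_nonneg _) hTD
  have hmem : ∀ᵐ x ∂lam, ∀ j, Γ.X bs k (N + j*T) x ∈ c := by
    rw [ae_all_iff]
    intro j
    have := Γ.ae_mem_R bs k (N + j*T)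
    rwa [hR j] at this
  filter_upwards [hmem, slln Z hZm' (T + D) hZb ho] with x hx hlim
  apply Γ.le_liminf_avg
  have hT' : (1:ℝ) ≤ T := by exact_mod_cast hT
  have hev : ∀ᶠ J : ℕ in atTop, -δ * J ≤ ∑ j ∈ Finset.range J, Z j x := by
    filter_upwards [hlim.eventually (lt_mem_nhds (show -δ < 0 by linarith)), eventually_gt_atTop 0] with J hJ hJ0
    have hJ' : (0:ℝ) < J := by exact_mod_cast hJ0
    rw [lt_div_iff₀ hJ'] at hJ
    exact hJ.le
  have hJt : Tendsto (fun n : ℕ => (n - N) / T) atTop atTop := by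
    refine tendsto_atTop.2 fun b => ?_
    filter_upwards [eventually_ge_atTop (b*T + N)] with n hn
    rw [Nat.le_div_iff_mul_le (by omega)]
    omega
  obtain ⟨M, hM⟩ := exists_nat_ge ((N + T : ℝ) / δ)
  filter_upwards [hJt.eventually hev, eventually_ge_atTop N, eventually_ge_atTop M, eventually_gt_atTop 0] with n hn hnN hnM hn0
  rcases lt_or_ge (γ - 2 * δ) 0 with hneg | hpos
  · exact le_trans (by linarith) (Γ.avg_nonneg _ _ _)
  set J := (n - N) / T with hJ
  have hJ1 : N + J * T ≤ n := by
    have := Nat.div_mul_le_self (n - N) T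
    rw [← hJ] at this
    omega
  have hJ2 : n ≤ N + J * T + T := by
    have := Nat.lt_div_mul_add (a := n - N) (b := T) (by omega)
    rw [← hJ] at this
    omega
  have hn' : (0:ℝ) < n := by exact_mod_cast hn0
  rw [avg_eq, one_div, le_inv_mul_iff₀ hn']
  have s1 : ∑ m ∈ Finset.range (N + J*T), Γ.g (Γ.X bs k m x) (bs m) ≤ ∑ m ∈ Finset.range n, Γ.g (Γ.X bs k m x) (bs m) :=
    Finset.sum_le_sum_of_subset_of_nonneg (Finset.range_mono hJ1) fun _ _ _ => Γ.g_nonneg _ _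
  rw [sum_blocks] at s1
  have s2 : 0 ≤ ∑ m ∈ Finset.range N, Γ.g (Γ.X bs k m x) (bs m) := Finset.sum_nonneg fun _ _ => Γ.g_nonneg _ _
  have s3 : (J:ℝ) * (T * (γ - δ)) + ∑ j ∈ Finset.range J, Z j x ≤ ∑ j ∈ Finset.range J, Y j x := by
    have : (J:ℝ) * (T * (γ - δ)) = ∑ j ∈ Finset.range J, (T * (γ - δ)) := by simp
    rw [this, ← Finset.sum_add_distrib]
    refine Finset.sum_le_sum fun j _ => ?_
    have := hV _ (hx j)
    simp only [hZ]; linarith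
  have hJ0 : (0:ℝ) ≤ J := by positivity
  have hJ2' : (n:ℝ) - N - T ≤ J * T := by
    have : (n:ℝ) ≤ N + J * T + T := by exact_mod_cast hJ2
    linarith
  have s4 : (J:ℝ) * T * (γ - 2 * δ) ≤ J * (T * (γ - δ)) + -δ * J := by
    have : 0 ≤ (J:ℝ) * (T - 1) * δ := by
      have : (0:ℝ) ≤ T - 1 := by linarith
      positivity
    nlinarith
  have s5 : ((n:ℝ) - N - T) * (γ - 2 * δ) ≤ J * T * (γ - 2 * δ) := mul_le_mul_of_nonneg_right hJ2' hpos
  have hM' : (N + T : ℝ) ≤ δ * n := by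
    have : (M:ℝ) ≤ n := by exact_mod_cast hnM
    rw [div_le_iff₀ hδ] at hM
    nlinarith
  have s6 : ((N:ℝ) + T) * (γ - 2 * δ) ≤ (N + T) * 1 :=
    mul_le_mul_of_nonneg_left (by linarith) (by positivity)
  have s7 : ∑ j ∈ Finset.range J, Y j x ≤ ∑ m ∈ Finset.range n, Γ.g (Γ.X bs k m x) (bs m) := by
    simp only [hY]; linarith
  nlinarith

end POMDP

theorem blind_eventuallyPeriodic_from_ergodic (Γ : POMDP) (hΓ : Γ.Blind)
    (p1 pstar : Γ.K → ℝ) (hp1 : IsBelief p1) (hps : IsBelief pstar)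
    (as : ℕ → Γ.A)
    (herg : ∀ k, 0 < pstar k →
      ∀ᵐ ω ∂(Γ.envMeasure (diracBelief k)),
        Tendsto (Γ.avg (Γ.blindStrat as) ω) atTop (nhds (Γ.payK k (Γ.blindStrat as))))
    (hval : Γ.pay pstar (Γ.blindStrat as) = Γ.val p1)
    (ε : ℝ) (hε : 0 < ε) :
    ∃ as' : ℕ → Γ.A, EventuallyPeriodic as' ∧
      Γ.pay pstar (Γ.blindStrat as') ≥ Γ.val p1 - ε := by
  classical
  set δ := ε / 3 with hδ
  have hδ0 : 0 < δ := by positivity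
  obtain ⟨c, hc⟩ := Finite.exists_infinite_fiber (fun m => fun k : Γ.K => Γ.R as 0 m {k})
  rw [Set.infinite_coe_iff] at hc
  obtain ⟨N, hNc, hN1⟩ := hc.exists_gt 0
  have hNc' : ∀ k, Γ.R as 0 N {k} = c k := fun k => congrFun hNc k
  have hthr : ∀ᶠ n : ℕ in atTop, ∀ k y, 0 < pstar k → y ∈ c k →
      (n:ℝ) * (Γ.payK k (Γ.blindStrat as) - δ) ≤ Γ.V as N n y := by
    rw [eventually_all]; intro k
    rw [eventually_all]; intro y
    by_cases hk : 0 < pstar k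
    swap
    · exact Eventually.of_forall fun n h => absurd h hk
    by_cases hy : y ∈ c k
    swap
    · exact Eventually.of_forall fun n _ h => absurd h hy
    have hpr : 0 < Γ.pr as k N y := by rw [← Γ.mem_R_iff, hNc']; exact hy
    have ht := Γ.V_tendsto as k _ N y hpr (Γ.ae_of_env k _ (herg k hk))
    filter_upwards [ht.eventually (lt_mem_nhds (show Γ.payK k (Γ.blindStrat as) - δ < _ by linarith)),
      eventually_gt_atTop 0] with n hn hn0 _ _
    have hn' : (0:ℝ) < n := by exact_mod_cast hn0
    rw [lt_div_iff₀ hn'] at hn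
    linarith
  obtain ⟨n0, hn0⟩ := eventually_atTop.1 hthr
  obtain ⟨M, hMc, hM⟩ := hc.exists_gt (N + n0)
  have hMc' : ∀ k, Γ.R as 0 M {k} = c k := fun k => congrFun hMc k
  obtain ⟨T, rfl⟩ : ∃ T, M = N + T := ⟨M - N, by omega⟩
  have hT1 : 1 ≤ T := by omega
  have hV := hn0 T (by omega)
  set bs : ℕ → Γ.A := fun m => if m < N then as m else as (N + (m - N) % T) with hbs
  have hper : ∀ j i, i < T → bs (N + j * T + i) = as (N + i) := by
    intro j i hi
    simp only [hbs]
    rw [if_neg (by omega), show N + j * T + i - N = i + j * T by omega, Nat.add_mul_mod_self_right,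
      Nat.mod_eq_of_lt hi]
  have hR : ∀ k j, Γ.R bs 0 (N + j * T) {k} = c k := by
    intro k j
    induction j with
    | zero =>
      rw [zero_mul, add_zero, ← hNc' k]
      apply Γ.R_congr
      intro i hi
      simp [hbs, hi]
    | succ j ih =>
      rw [show N + (j+1) * T = (N + j * T) + T by ring, Γ.R_add, ih, zero_add,
        Γ.R_congr bs as (N + j*T) N T _ (hper j)]
      have := hMc' k
      rw [Γ.R_add, hNc', zero_add] at this
      exact this
  refine ⟨bs, ⟨T, hT1, N, hN1, ?_⟩, ?_⟩
  · intro m hm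
    simp only [hbs]
    rw [if_neg (by omega), if_neg (by omega), show m + T - N = (m - N) + T by omega, Nat.add_mod_right]
  · rw [← hval, Γ.pay_eq _ hps.1, Γ.pay_eq _ hps.1]
    have hint : ∀ k, Integrable (fun x => atTop.liminf (Γ.avg (Γ.blindStrat bs) (k, x))) lam := fun k =>
      POMDP.bdd_int ((Γ.liminf_meas bs).comp measurable_prodMk_left) 1 fun x => by
        rw [abs_of_nonneg (Γ.liminf_nonneg bs _)]; exact Γ.liminf_le_one bs _
    have hle1 : ∀ k, Γ.payK k (Γ.blindStrat as) ≤ 1 := by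
      intro k
      rw [Γ.payK_eq]
      calc _ ≤ ∫ x, (1:ℝ) ∂lam := by
            refine integral_mono (POMDP.bdd_int ((Γ.liminf_meas as).comp measurable_prodMk_left) 1 fun x => ?_)
              (integrable_const _) fun x => Γ.liminf_le_one as _
            rw [abs_of_nonneg (Γ.liminf_nonneg as _)]; exact Γ.liminf_le_one as _
        _ = 1 := by simp
    have hk : ∀ k, pstar k * (∫ x, atTop.liminf (Γ.avg (Γ.blindStrat as) (k, x)) ∂lam - ε)
        ≤ pstar k * ∫ x, atTop.liminf (Γ.avg (Γ.blindStrat bs) (k, x)) ∂lam := by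
      intro k
      rcases (hps.1 k).eq_or_lt with h0 | h0
      · simp [← h0]
      refine mul_le_mul_of_nonneg_left ?_ h0.le
      rw [← Γ.payK_eq]
      have hb := Γ.block as bs k N T hT1 hper (c k) (hR k) (Γ.payK k (Γ.blindStrat as)) δ (hle1 k) hδ0
        (fun y hy => hV k y h0 hy)
      have : ∫ x, (Γ.payK k (Γ.blindStrat as) - 3 * δ) ∂lam ≤ ∫ x, atTop.liminf (Γ.avg (Γ.blindStrat bs) (k, x)) ∂lam :=
        integral_mono_ae (integrable_const _) (hint k) hb
      rw [integral_const, probReal_univ, one_smul] at this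
      linarith
    have hsum := Finset.sum_le_sum fun k (_ : k ∈ Finset.univ) => hk k
    simp only [mul_sub, Finset.sum_sub_distrib] at hsum
    rw [← Finset.sum_mul, hps.2, one_mul] at hsum
    exact hsum

end PomdpPaper
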